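/- Assume (h1) and (f1)–(f3). Let u : ℤ^d → ℝ with u ≥ 0, u ≢ 0 and ‖u‖_{H_{s,p}} < ∞. Then for every real t ≥ 1, ∑_{x∈ℤ^d}(R_α∗F(tu))(x)·F(tu(x)) ≥ t^θ · ∑_{x∈ℤ^d}(R_α∗F(u))(x)·F(u(x)) (both double series converge absolutely). -/

import Mathlib

open MeasureTheory Filter Topology
open scoped ENNReal

noncomputable section

namespace DiscreteChoquard

variable {d : ℕ}

/-- The lattice `ℤ^d`. -/
abbrev Z (d : ℕ) := Fin d → ℤ

/-- Graph distance on `ℤ^d`, as a real number. -/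
def latDist (x y : Z d) : ℝ := ∑ i, |((x i - y i : ℤ) : ℝ)|

/-- The kernel hypotheses on `W_s`: symmetry, positivity, and the two-sided bound
`c|x−y|^{−d−2s} ≤ W_s(x,y) ≤ C|x−y|^{−d−2s}` for `x ≠ y`. -/
def KernelOK (d : ℕ) (s : ℝ) (W : Z d → Z d → ℝ) : Prop :=
  (∀ x y, W x y = W y x) ∧ (∀ x y, 0 < W x y) ∧
  ∃ c C : ℝ, 0 < c ∧ c ≤ C ∧ ∀ x y : Z d, x ≠ y →
    c * latDist x y ^ (-(d : ℝ) - 2 * s) ≤ W x y ∧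
      W x y ≤ C * latDist x y ^ (-(d : ℝ) - 2 * s)

/-- The fractional gradient form `∇^s u ∇^s v (x)`.  (The `y = x` summand vanishes, so we
sum over all `y`.) -/
def gradForm (W : Z d → Z d → ℝ) (u v : Z d → ℝ) (x : Z d) : ℝ :=
  (1 / 2) * ∑' y : Z d, W x y * (u x - u y) * (v x - v y)

/-- `|∇^s u|(x)`. -/
def gradNorm (W : Z d → Z d → ℝ) (u : Z d → ℝ) (x : Z d) : ℝ :=
  Real.sqrt ((1 / 2) * ∑' y : Z d, W x y * (u x - u y) ^ 2)

/-- The fractional `p`-Laplacian `(−Δ)_p^s u (x)`. -/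
def pLap (W : Z d → Z d → ℝ) (p : ℝ) (u : Z d → ℝ) (x : Z d) : ℝ :=
  (1 / 2) * ∑' y : Z d,
    W x y * (gradNorm W u x ^ (p - 2) + gradNorm W u y ^ (p - 2)) * (u x - u y)

/-- `‖u‖_{H_{s,p}}^p = ∑_x (|∇^s u|^p(x) + h(x)|u(x)|^p)`. -/
def HnormP (W : Z d → Z d → ℝ) (h : Z d → ℝ) (p : ℝ) (u : Z d → ℝ) : ℝ :=
  ∑' x : Z d, (gradNorm W u x ^ p + h x * |u x| ^ p)

/-- `‖u‖_{H_{s,p}}`. -/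
def normH (W : Z d → Z d → ℝ) (h : Z d → ℝ) (p : ℝ) (u : Z d → ℝ) : ℝ :=
  HnormP W h p u ^ (1 / p)

/-- Membership `u ∈ H_{s,p}`, i.e. `‖u‖_{H_{s,p}} < ∞` (all the defining series converge). -/
def memH (W : Z d → Z d → ℝ) (h : Z d → ℝ) (p : ℝ) (u : Z d → ℝ) : Prop :=
  (∀ x : Z d, Summable fun y : Z d => W x y * (u x - u y) ^ 2) ∧
  Summable fun x : Z d => gradNorm W u x ^ p + h x * |u x| ^ p

/-- The `ℓ^q` norm on `ℤ^d`. -/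
def lnorm (q : ℝ) (u : Z d → ℝ) : ℝ := (∑' x : Z d, |u x| ^ q) ^ (1 / q)

/-- The torus box `[0, 2π]^d`. -/
def box (d : ℕ) : Set (Fin d → ℝ) := Set.univ.pi fun _ => Set.Icc 0 (2 * Real.pi)

/-- `μ(k) = 2d − 2 ∑_j cos k_j`. -/
def muk (d : ℕ) (k : Fin d → ℝ) : ℝ := 2 * d - 2 * ∑ j, Real.cos (k j)

/-- The fractional degree `K_α = (2π)^{-d} ∫_{[0,2π]^d} μ(k)^{α/2} dk`. -/
def Kfrac (d : ℕ) (α : ℝ) : ℝ :=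
  (2 * Real.pi) ^ (-(d : ℝ)) * ∫ k in box d, muk d k ^ (α / 2)

/-- The Green's function `R_α(x,y)` of the discrete fractional Laplacian. -/
def Riesz (d : ℕ) (α : ℝ) (x y : Z d) : ℝ :=
  Kfrac d α * (2 * Real.pi) ^ (-(d : ℝ)) *
    ∫ k in box d, Real.cos (∑ j, ((x j - y j : ℤ) : ℝ) * k j) * muk d k ^ (-(α / 2))

/-- The convolution `(R_α ∗ v)(x) = ∑_y R_α(x,y) v(y)`. -/
def conv (d : ℕ) (α : ℝ) (v : Z d → ℝ) (x : Z d) : ℝ := ∑' y : Z d, Riesz d α x y * v y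

/-- `F(t) = ∫_0^t f(r) dr`. -/
def Fint (f : ℝ → ℝ) (t : ℝ) : ℝ := ∫ r in (0 : ℝ)..t, f r

/-- Positive part `u⁺ = max(u,0)`. -/
def pos (u : Z d → ℝ) (x : Z d) : ℝ := max (u x) 0

/-- Negative part `u⁻ = min(u,0)`. -/
def negp (u : Z d → ℝ) (x : Z d) : ℝ := min (u x) 0

/-- Hypothesis (h2): `h(x) → ∞` as `|x| → ∞`. -/
def H2 (h : Z d → ℝ) : Prop := Tendsto h cofinite atTop

/-- Hypothesis (f1): `f(t) = o(t^{p−1})` as `t → 0⁺`. -/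
def F1 (f : ℝ → ℝ) (p : ℝ) : Prop :=
  ∀ ε > (0 : ℝ), ∃ δ > (0 : ℝ), ∀ t : ℝ, 0 < t → t < δ → |f t| ≤ ε * t ^ (p - 1)

/-- Hypothesis (f3): `0 ≤ θ F(t) ≤ 2 f(t) t` for `t > 0`. -/
def F3 (f : ℝ → ℝ) (θ : ℝ) : Prop :=
  ∀ t > (0 : ℝ), 0 ≤ θ * Fint f t ∧ θ * Fint f t ≤ 2 * f t * t

/-- The energy functional `J̃`. -/
def energy (W : Z d → Z d → ℝ) (h : Z d → ℝ) (p α : ℝ) (f : ℝ → ℝ) (u : Z d → ℝ) : ℝ :=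
  (1 / p) * HnormP W h p u -
    (1 / 2) * ∑' x : Z d, conv d α (fun y => Fint f (pos u y)) x * Fint f (pos u x)

/-- The Nehari set `M`. -/
def Nehari (W : Z d → Z d → ℝ) (h : Z d → ℝ) (p α : ℝ) (f : ℝ → ℝ) : Set (Z d → ℝ) :=
  {u | memH W h p u ∧ u ≠ 0 ∧
    HnormP W h p u =
      ∑' x : Z d, conv d α (fun y => Fint f (pos u y)) x * f (pos u x) * pos u x}

/-- Hypothesis (f4). -/
def F4 (W : Z d → Z d → ℝ) (h : Z d → ℝ) (p α : ℝ) (f : ℝ → ℝ) : Prop :=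
  ∀ u : Z d → ℝ, memH W h p u → pos u ≠ 0 →
    StrictMonoOn (fun t : ℝ =>
      t ^ (1 - p) *
        ∑' x : Z d, conv d α (fun y => Fint f (t * pos u y)) x * f (t * pos u x) * pos u x)
      (Set.Ioi 0)

/-- The derivative pairing `⟨J̃′(u), φ⟩`. -/
def pairing (W : Z d → Z d → ℝ) (h : Z d → ℝ) (p α : ℝ) (f : ℝ → ℝ) (u φ : Z d → ℝ) : ℝ :=
  (∑' x : Z d,
      (gradNorm W u x ^ (p - 2) * gradForm W u φ x + h x * |u x| ^ (p - 2) * u x * φ x)) -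
    ∑' x : Z d, conv d α (fun y => Fint f (pos u y)) x * f (pos u x) * φ x

/-! ### Nonnegativity and boundedness of the Riesz kernel -/

lemma continuous_phase (m : Z d) :
    Continuous fun k : Fin d → ℝ => ∑ j, ((m j : ℤ) : ℝ) * k j := by fun_prop

lemma isCompact_box (d : ℕ) : IsCompact (box d) :=
  isCompact_univ_pi fun _ => isCompact_Icc

lemma integrable_box_of_continuous {g : (Fin d → ℝ) → ℝ} (hg : Continuous g) :
    Integrable g (volume.restrict (box d)) :=
  hg.continuousOn.integrableOn_compact (isCompact_box d)

lemma box_restrict (d : ℕ) : (volume : Measure (Fin d → ℝ)).restrict (box d) =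
    Measure.pi fun _ => (volume : Measure ℝ).restrict (Set.Icc 0 (2 * Real.pi)) := by
  rw [box, volume_pi, Measure.restrict_pi_pi]

lemma one_dim_exp (n : ℤ) :
    ∫ x in Set.Icc (0 : ℝ) (2 * Real.pi), Complex.exp (((n : ℂ) * Complex.I) * (x : ℂ)) =
      if n = 0 then ((2 * Real.pi : ℝ) : ℂ) else 0 := by
  rw [integral_Icc_eq_integral_Ioc, ← intervalIntegral.integral_of_le (by positivity)]
  split_ifs with hn
  · subst hn; simp
  · have hc : ((n : ℂ) * Complex.I) ≠ 0 := by
      simp [hn]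
    rw [integral_exp_mul_complex hc]
    have : Complex.exp ((n : ℂ) * Complex.I * ((2 * Real.pi : ℝ) : ℂ)) = 1 := by
      rw [Complex.exp_eq_one_iff]
      exact ⟨n, by push_cast; ring⟩
    rw [this]; simp

lemma integral_cos_nonneg (m : Z d) :
    0 ≤ ∫ k in box d, Real.cos (∑ j, ((m j : ℤ) : ℝ) * k j) := by
  have h1 : ∀ k : Fin d → ℝ, ((Real.cos (∑ j, ((m j : ℤ) : ℝ) * k j) : ℝ)) =
      RCLike.re (∏ j, Complex.exp ((((m j : ℤ) : ℂ) * Complex.I) * (k j : ℂ))) := by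
    intro k
    rw [← Complex.exp_sum]
    have : ∑ j, (((m j : ℤ) : ℂ) * Complex.I) * (k j : ℂ) =
        ((∑ j, ((m j : ℤ) : ℝ) * k j : ℝ) : ℂ) * Complex.I := by
      push_cast
      rw [Finset.sum_mul]
      exact Finset.sum_congr rfl fun j _ => by ring
    rw [this]
    simp only [RCLike.re_eq_complex_re]
    rw [Complex.exp_ofReal_mul_I_re]
  simp_rw [h1]
  rw [integral_re, box_restrict, integral_fintype_prod_eq_prod (𝕜 := ℂ)
    (fun (j : Fin d) (x : ℝ) => Complex.exp ((((m j : ℤ) : ℂ) * Complex.I) * (x : ℂ)))]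
  · simp_rw [one_dim_exp]
    have : (∏ j : Fin d, if m j = 0 then ((2 * Real.pi : ℝ) : ℂ) else 0) =
      ((∏ j : Fin d, if m j = 0 then (2 * Real.pi : ℝ) else 0 : ℝ) : ℂ) := by
      rw [Complex.ofReal_prod]
      exact Finset.prod_congr rfl fun j _ => by split_ifs <;> simp
    rw [this]
    simp only [RCLike.re_eq_complex_re, Complex.ofReal_re]
    exact Finset.prod_nonneg fun j _ => by split_ifs <;> positivity
  · have : Continuous fun k : Fin d → ℝ =>
      ∏ j, Complex.exp ((((m j : ℤ) : ℂ) * Complex.I) * (k j : ℂ)) := by fun_prop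
    exact this.continuousOn.integrableOn_compact (isCompact_box d)

lemma integral_cos_pow_nonneg (n : ℕ) : ∀ m : Z d,
    0 ≤ ∫ k in box d, Real.cos (∑ j, ((m j : ℤ) : ℝ) * k j) * (∑ j, Real.cos (k j)) ^ n := by
  induction n with
  | zero => intro m; simpa using integral_cos_nonneg m
  | succ n ih =>
    intro m
    have key : ∀ k : Fin d → ℝ,
        Real.cos (∑ j, ((m j : ℤ) : ℝ) * k j) * (∑ j, Real.cos (k j)) ^ (n + 1) =
        ∑ i : Fin d, ((1 / 2) * (Real.cos (∑ j, (((m + Pi.single i 1 : Z d) j : ℤ) : ℝ) * k j) *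
            (∑ j, Real.cos (k j)) ^ n) +
          (1 / 2) * (Real.cos (∑ j, (((m - Pi.single i 1 : Z d) j : ℤ) : ℝ) * k j) *
            (∑ j, Real.cos (k j)) ^ n)) := by
      intro k
      rw [pow_succ, mul_comm (_ ^ n), ← mul_assoc, Finset.mul_sum, Finset.sum_mul]
      refine Finset.sum_congr rfl fun i _ => ?_
      have e : ∑ j, (((Pi.single i 1 : Z d) j : ℤ) : ℝ) * k j = k i := by
        rw [Finset.sum_eq_single i]
        · simp
        · intro b _ hb; simp [hb]
        · simp
      have e1 : ∑ j, (((m + Pi.single i 1 : Z d) j : ℤ) : ℝ) * k j =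
          ∑ j, ((m j : ℤ) : ℝ) * k j + k i := by
        conv_rhs => rw [← e]
        rw [← Finset.sum_add_distrib]
        refine Finset.sum_congr rfl fun j _ => ?_
        rw [Pi.add_apply]; push_cast; ring
      have e2 : ∑ j, (((m - Pi.single i 1 : Z d) j : ℤ) : ℝ) * k j =
          ∑ j, ((m j : ℤ) : ℝ) * k j - k i := by
        conv_rhs => rw [← e]
        rw [← Finset.sum_sub_distrib]
        refine Finset.sum_congr rfl fun j _ => ?_
        rw [Pi.sub_apply]; push_cast; ring
      rw [e1, e2, Real.cos_add, Real.cos_sub]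
      ring
    simp_rw [key]
    have hc : ∀ m : Z d, Integrable (fun k : Fin d → ℝ =>
        (1 / 2 : ℝ) * (Real.cos (∑ j, ((m j : ℤ) : ℝ) * k j) * (∑ j, Real.cos (k j)) ^ n))
        (volume.restrict (box d)) := fun m =>
      integrable_box_of_continuous (by fun_prop)
    rw [integral_finsetSum]
    swap
    · exact fun i _ => (hc (m + Pi.single i 1)).add (hc (m - Pi.single i 1))
    refine Finset.sum_nonneg fun i _ => ?_
    rw [integral_add (hc _) (hc _), integral_const_mul, integral_const_mul]
    have := ih (m + Pi.single i 1)
    have := ih (m - Pi.single i 1)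
    positivity

lemma abs_sum_cos_le (k : Fin d → ℝ) : |∑ j, Real.cos (k j)| ≤ d := by
  refine (Finset.abs_sum_le_sum_abs _ _).trans ?_
  refine (Finset.sum_le_sum fun j _ => Real.abs_cos_le_one (k j)).trans ?_
  simp

lemma integral_cos_exp_nonneg (m : Z d) {c : ℝ} (hc : 0 ≤ c) :
    0 ≤ ∫ k in box d, Real.cos (∑ j, ((m j : ℤ) : ℝ) * k j) *
      Real.exp (c * ∑ j, Real.cos (k j)) := by
  set G : ℕ → (Fin d → ℝ) → ℝ := fun n k =>
    (c ^ n / n.factorial) * (Real.cos (∑ j, ((m j : ℤ) : ℝ) * k j) * (∑ j, Real.cos (k j)) ^ n)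
    with hG
  have h1 : ∀ k : Fin d → ℝ, Real.cos (∑ j, ((m j : ℤ) : ℝ) * k j) *
      Real.exp (c * ∑ j, Real.cos (k j)) = ∑' n, G n k := by
    intro k
    rw [Real.exp_eq_exp_ℝ, NormedSpace.exp_eq_tsum_div, ← tsum_mul_left]
    refine tsum_congr fun n => ?_
    simp only [hG, mul_pow]
    ring
  have hint : ∀ n, Integrable (G n) (volume.restrict (box d)) := fun n =>
    integrable_box_of_continuous (by fun_prop)
  have : IsFiniteMeasure ((volume : Measure (Fin d → ℝ)).restrict (box d)) :=
    ⟨by simpa using (isCompact_box d).measure_lt_top⟩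
  have hb : ∀ n k, ‖G n k‖ ≤ (c * d) ^ n / n.factorial := by
    intro n k
    simp only [hG, norm_mul, norm_div, norm_pow, Real.norm_eq_abs, abs_of_nonneg hc, mul_pow]
    rw [abs_of_nonneg (by positivity : (0 : ℝ) ≤ (n.factorial : ℝ))]
    have h2 : |Real.cos (∑ j, ((m j : ℤ) : ℝ) * k j)| * |∑ j, Real.cos (k j)| ^ n ≤
        1 * (d : ℝ) ^ n := by
      gcongr
      · exact Real.abs_cos_le_one _
      · exact abs_sum_cos_le k
    calc _ ≤ c ^ n / n.factorial * (1 * (d : ℝ) ^ n) := by gcongr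
      _ = _ := by ring
  have hsum : Summable fun n => ∫ k in box d, ‖G n k‖ := by
    refine Summable.of_nonneg_of_le (fun n => integral_nonneg fun k => norm_nonneg _) (fun n => ?_)
      ((Real.summable_pow_div_factorial (c * d)).mul_left
        (((volume : Measure (Fin d → ℝ)).restrict (box d)).real Set.univ))
    have := integral_mono (hint n).norm (integrable_const _) (hb n)
    simpa using this
  simp_rw [h1]
  rw [← integral_tsum_of_summable_integral_norm hint hsum]
  refine tsum_nonneg fun n => ?_
  simp only [hG]
  rw [integral_const_mul]
  exact mul_nonneg (by positivity) (integral_cos_pow_nonneg n m)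

lemma muk_eq (k : Fin d → ℝ) : muk d k = ∑ j, (2 - 2 * Real.cos (k j)) := by
  simp [muk, Finset.sum_sub_distrib, Finset.mul_sum, mul_comm]

lemma term_nonneg (x : ℝ) : 0 ≤ 2 - 2 * Real.cos x := by
  linarith [Real.cos_le_one x]

lemma muk_nonneg (k : Fin d → ℝ) : 0 ≤ muk d k := by
  rw [muk_eq]; exact Finset.sum_nonneg fun j _ => term_nonneg _

lemma continuous_muk (d : ℕ) : Continuous (muk d) := by
  unfold muk; fun_prop

lemma term_pos {x : ℝ} (hx : x ∈ Set.Ioo 0 (2 * Real.pi)) : 0 < 2 - 2 * Real.cos x := by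
  rcases lt_or_eq_of_le (Real.cos_le_one x) with h | h
  · linarith
  · exfalso
    have := (Real.cos_eq_one_iff_of_lt_of_lt (by linarith [hx.1, Real.pi_pos]) hx.2).1 h
    exact hx.1.ne' this

lemma ae_box (d : ℕ) : ∀ᵐ k ∂(volume : Measure (Fin d → ℝ)).restrict (box d),
    ∀ j, k j ∈ Set.Ioo 0 (2 * Real.pi) := by
  have h1 : (Set.univ.pi fun _ : Fin d => Set.Ioo (0 : ℝ) (2 * Real.pi)) =ᵐ[volume] box d := by
    have := Measure.univ_pi_Ioo_ae_eq_Icc (μ := fun _ : Fin d => (volume : Measure ℝ))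
      (f := fun _ => 0) (g := fun _ => 2 * Real.pi)
    rw [← Set.pi_univ_Icc] at this
    exact this
  rw [← Measure.restrict_congr_set h1]
  filter_upwards [ae_restrict_mem (MeasurableSet.univ_pi fun _ => measurableSet_Ioo)] with k hk j
  exact hk j (Set.mem_univ j)

lemma ae_muk_pos (hd : 0 < d) : ∀ᵐ k ∂(volume : Measure (Fin d → ℝ)).restrict (box d),
    0 < muk d k := by
  filter_upwards [ae_box d] with k hk
  rw [muk_eq]
  have : Nonempty (Fin d) := ⟨⟨0, hd⟩⟩
  exact Finset.sum_pos (fun j _ => term_pos (hk j)) Finset.univ_nonempty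

/-- Lower bound for one Fourier factor. -/
lemma term_lower {x : ℝ} (hx : x ∈ Set.Icc 0 Real.pi) :
    (2 / Real.pi * x) ^ 2 ≤ 2 - 2 * Real.cos x := by
  have h1 : 2 - 2 * Real.cos x = (2 * Real.sin (x / 2)) ^ 2 := by
    have := Real.cos_two_mul (x / 2)
    rw [show 2 * (x / 2) = x by ring] at this
    have h2 := Real.sin_sq_add_cos_sq (x / 2)
    nlinarith
  rw [h1]
  have hpi := Real.pi_pos
  have h0 := hx.1
  have := Real.mul_le_sin (x := x / 2) (by linarith [hx.1]) (by linarith [hx.2])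
  have h3 : 2 / Real.pi * x ≤ 2 * Real.sin (x / 2) := by linarith
  gcongr

lemma term_rpow_le {b : ℝ} (hb : 0 < b) {x : ℝ} (hx : x ∈ Set.Ioo 0 (2 * Real.pi)) :
    (2 - 2 * Real.cos x) ^ (-(b / 2)) ≤
      (2 / Real.pi) ^ (-b) * (x ^ (-b) + (2 * Real.pi - x) ^ (-b)) := by
  have hpi := Real.pi_pos
  have aux : ∀ y ∈ Set.Ioc 0 Real.pi, (2 - 2 * Real.cos y) ^ (-(b / 2)) ≤
      (2 / Real.pi) ^ (-b) * y ^ (-b) := by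
    intro y hy
    have hy0 := hy.1
    have h := term_lower ⟨hy.1.le, hy.2⟩
    have hp : 0 < (2 / Real.pi * y) ^ 2 := by positivity
    calc _ ≤ ((2 / Real.pi * y) ^ 2) ^ (-(b / 2)) :=
          Real.rpow_le_rpow_of_nonpos hp h (by linarith)
      _ = (2 / Real.pi * y) ^ (-b) := by
          rw [← Real.rpow_natCast, ← Real.rpow_mul (by positivity)]
          congr 1; push_cast; ring
      _ = _ := Real.mul_rpow (by positivity) hy.1.le
  have hx0 := hx.1
  have hx1 : 0 < 2 * Real.pi - x := by linarith [hx.2]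
  rcases le_total x Real.pi with h | h
  · refine (aux x ⟨hx.1, h⟩).trans ?_
    gcongr
    have : 0 ≤ (2 * Real.pi - x) ^ (-b) := by positivity
    linarith
  · have := aux (2 * Real.pi - x) ⟨hx1, by linarith⟩
    rw [Real.cos_two_pi_sub] at this
    refine this.trans ?_
    gcongr
    have : 0 ≤ x ^ (-b) := by positivity
    linarith

lemma one_dim_integrable {b : ℝ} (hb0 : 0 < b) (hb : b < 1) :
    Integrable (fun x : ℝ => (2 - 2 * Real.cos x) ^ (-(b / 2)))
      (volume.restrict (Set.Icc 0 (2 * Real.pi))) := by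
  have hpi := Real.pi_pos
  have h1 : IntervalIntegrable (fun x : ℝ => x ^ (-b)) volume 0 (2 * Real.pi) :=
    intervalIntegral.intervalIntegrable_rpow' (by linarith)
  have h2 : IntervalIntegrable (fun x : ℝ => (2 * Real.pi - x) ^ (-b)) volume 0 (2 * Real.pi) := by
    have := (h1.comp_sub_left (2 * Real.pi)).symm
    simpa using this
  have h3 := (h1.add h2).const_mul ((2 / Real.pi) ^ (-b))
  rw [intervalIntegrable_iff_integrableOn_Ioo_of_le (by positivity)] at h3
  have h4 : (volume : Measure ℝ).restrict (Set.Icc 0 (2 * Real.pi)) =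
      volume.restrict (Set.Ioo 0 (2 * Real.pi)) :=
    (Measure.restrict_congr_set Ioo_ae_eq_Icc).symm
  rw [h4]
  refine Integrable.mono' h3 ?_ ?_
  · exact Measurable.aestronglyMeasurable (by fun_prop)
  · filter_upwards [ae_restrict_mem measurableSet_Ioo] with x hx
    rw [Real.norm_of_nonneg (Real.rpow_nonneg (term_nonneg x) _)]
    exact term_rpow_le hb0 hx

lemma integrable_muk_rpow (hd : 0 < d) {α : ℝ} (hα : α ∈ Set.Ioo (0 : ℝ) (d : ℝ)) :
    Integrable (fun k => muk d k ^ (-(α / 2))) (volume.restrict (box d)) := by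
  have hd' : (0 : ℝ) < d := by exact_mod_cast hd
  have hb0 : 0 < α / d := div_pos hα.1 hd'
  have hb1 : α / d < 1 := (div_lt_one hd').2 hα.2
  have hprod : Integrable (fun k : Fin d → ℝ => ∏ j, (2 - 2 * Real.cos (k j)) ^ (-(α / d / 2)))
      (volume.restrict (box d)) := by
    rw [box_restrict]
    exact Integrable.fintype_prod (f := fun _ x => (2 - 2 * Real.cos x) ^ (-(α / d / 2)))
      fun _ => one_dim_integrable hb0 hb1
  refine Integrable.mono' hprod ?_ ?_
  · have := (continuous_muk d).measurable
    exact Measurable.aestronglyMeasurable (by fun_prop)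
  · filter_upwards [ae_box d, ae_muk_pos hd] with k hk hmu
    rw [Real.norm_of_nonneg (Real.rpow_nonneg (muk_nonneg k) _)]
    have h1 : muk d k ^ (-(α / 2)) = ∏ _j : Fin d, muk d k ^ (-(α / d / 2)) := by
      rw [Finset.prod_const, ← Real.rpow_natCast, ← Real.rpow_mul hmu.le]
      congr 1
      simp only [Finset.card_univ, Fintype.card_fin]
      field_simp
    rw [h1]
    refine Finset.prod_le_prod (fun j _ => by positivity) fun j _ => ?_
    refine Real.rpow_le_rpow_of_nonpos (term_pos (hk j)) ?_ (by linarith)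
    rw [muk_eq]
    exact Finset.single_le_sum (f := fun j => 2 - 2 * Real.cos (k j))
      (fun i _ => term_nonneg (k i)) (Finset.mem_univ j)

lemma integral_cos_muk_nonneg (hd : 0 < d) {α : ℝ} (hα : α ∈ Set.Ioo (0 : ℝ) (d : ℝ))
    (m : Z d) :
    0 ≤ ∫ k in box d, Real.cos (∑ j, ((m j : ℤ) : ℝ) * k j) * muk d k ^ (-(α / 2)) := by
  set a := α / 2 with ha
  have ha0 : 0 < a := half_pos hα.1
  have hΓ := Real.Gamma_pos_of_pos ha0
  set Φ : (Fin d → ℝ) → ℝ → ℝ := fun k t =>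
    Real.cos (∑ j, ((m j : ℤ) : ℝ) * k j) * (t ^ (a - 1) * Real.exp (-(muk d k * t))) with hΦ
  have hgam : ∀ r : ℝ, 0 < r → ∫ t in Set.Ioi (0 : ℝ), t ^ (a - 1) * Real.exp (-(r * t)) =
      Real.Gamma a * r ^ (-a) := by
    intro r hr
    rw [Real.integral_rpow_mul_exp_neg_mul_Ioi ha0 hr, one_div, Real.inv_rpow hr.le,
      Real.rpow_neg hr.le, mul_comm]
  have hgint : ∀ r : ℝ, 0 < r → Integrable (fun t : ℝ => t ^ (a - 1) * Real.exp (-(r * t)))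
      (volume.restrict (Set.Ioi 0)) := by
    intro r hr
    by_contra hcon
    have h1 := integral_undef hcon
    rw [hgam r hr] at h1
    have : 0 < Real.Gamma a * r ^ (-a) := by positivity
    linarith
  have hin : ∀ k : Fin d → ℝ, 0 < muk d k → ∫ t in Set.Ioi (0 : ℝ), Φ k t =
      Real.Gamma a * (Real.cos (∑ j, ((m j : ℤ) : ℝ) * k j) * muk d k ^ (-a)) := by
    intro k hk
    simp only [hΦ]
    rw [integral_const_mul, hgam _ hk]; ring
  have hmeas : Measurable (Function.uncurry Φ) := by
    have h1 := (continuous_muk d).measurable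
    have h2 := (continuous_phase m).measurable
    simp only [hΦ, Function.uncurry_def]
    fun_prop
  have hInt : Integrable (Function.uncurry Φ)
      (((volume : Measure (Fin d → ℝ)).restrict (box d)).prod
        ((volume : Measure ℝ).restrict (Set.Ioi 0))) := by
    rw [integrable_prod_iff hmeas.aestronglyMeasurable]
    constructor
    · filter_upwards [ae_muk_pos hd] with k hk
      exact (hgint _ hk).const_mul (Real.cos (∑ j, ((m j : ℤ) : ℝ) * k j))
    · have hmain : Integrable (fun k => Real.Gamma a *
          (|Real.cos (∑ j, ((m j : ℤ) : ℝ) * k j)| * muk d k ^ (-a)))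
          (volume.restrict (box d)) := by
        refine Integrable.const_mul ?_ _
        refine (integrable_muk_rpow hd hα).bdd_mul (c := 1) ?_ ?_
        · exact Continuous.aestronglyMeasurable (by fun_prop)
        · refine Filter.Eventually.of_forall fun k => ?_
          simpa using Real.abs_cos_le_one _
      refine hmain.congr ?_
      filter_upwards [ae_muk_pos hd] with k hk
      have : ∫ t in Set.Ioi (0 : ℝ), ‖Φ k t‖ = ∫ t in Set.Ioi (0 : ℝ),
          |Real.cos (∑ j, ((m j : ℤ) : ℝ) * k j)| *
            (t ^ (a - 1) * Real.exp (-(muk d k * t))) := by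
        refine setIntegral_congr_fun measurableSet_Ioi fun t ht => ?_
        have ht' : 0 < t := ht
        simp only [hΦ, norm_mul, Real.norm_eq_abs, Real.abs_exp]
        rw [abs_of_nonneg (Real.rpow_nonneg ht'.le _)]
      simp only [Function.uncurry_apply_pair]
      rw [this, integral_const_mul, hgam _ hk]; ring
  have hswap := integral_integral_swap hInt
  have hL : ∫ k in box d, ∫ t in Set.Ioi (0 : ℝ), Φ k t = Real.Gamma a *
      ∫ k in box d, Real.cos (∑ j, ((m j : ℤ) : ℝ) * k j) * muk d k ^ (-a) := by
    rw [← integral_const_mul]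
    refine integral_congr_ae ?_
    filter_upwards [ae_muk_pos hd] with k hk
    exact hin k hk
  have hR : 0 ≤ ∫ t in Set.Ioi (0 : ℝ), ∫ k in box d, Φ k t := by
    refine setIntegral_nonneg measurableSet_Ioi fun t ht => ?_
    have ht' : 0 < t := ht
    have : ∀ k, Φ k t = (t ^ (a - 1) * Real.exp (-(2 * d * t))) *
        (Real.cos (∑ j, ((m j : ℤ) : ℝ) * k j) * Real.exp (2 * t * ∑ j, Real.cos (k j))) := by
      intro k
      have e : Real.exp (-(muk d k * t)) =
          Real.exp (-(2 * d * t)) * Real.exp (2 * t * ∑ j, Real.cos (k j)) := by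
        rw [← Real.exp_add]; congr 1; simp only [muk]; ring
      simp only [hΦ]
      rw [e]; ring
    simp_rw [this]
    rw [integral_const_mul]
    exact mul_nonneg (by positivity) (integral_cos_exp_nonneg m (by positivity))
  rw [← hswap, hL] at hR
  exact nonneg_of_mul_nonneg_right hR hΓ

lemma Kfrac_nonneg (d : ℕ) (α : ℝ) : 0 ≤ Kfrac d α :=
  mul_nonneg (by positivity) (integral_nonneg fun k => Real.rpow_nonneg (muk_nonneg k) _)

lemma Riesz_nonneg (hd : 0 < d) {α : ℝ} (hα : α ∈ Set.Ioo (0 : ℝ) (d : ℝ)) (x y : Z d) :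
    0 ≤ Riesz d α x y :=
  mul_nonneg (mul_nonneg (Kfrac_nonneg d α) (by positivity))
    (integral_cos_muk_nonneg hd hα (x - y))

lemma Riesz_bounded (hd : 0 < d) {α : ℝ} (hα : α ∈ Set.Ioo (0 : ℝ) (d : ℝ)) :
    ∃ B : ℝ, ∀ x y : Z d, Riesz d α x y ≤ B := by
  refine ⟨Kfrac d α * (2 * Real.pi) ^ (-(d : ℝ)) * ∫ k in box d, muk d k ^ (-(α / 2)),
    fun x y => ?_⟩
  refine mul_le_mul_of_nonneg_left ?_ (mul_nonneg (Kfrac_nonneg d α) (by positivity))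
  have hI := integrable_muk_rpow hd hα
  refine integral_mono ?_ hI fun k => ?_
  · refine hI.bdd_mul (c := 1) ?_ ?_
    · exact Continuous.aestronglyMeasurable (by fun_prop)
    · refine Filter.Eventually.of_forall fun k => ?_
      simpa using Real.abs_cos_le_one _
  · exact mul_le_of_le_one_left (Real.rpow_nonneg (muk_nonneg k) _) (Real.cos_le_one _)

/-! ### The primitive `F` -/

lemma Fint_nonneg {f : ℝ → ℝ} {θ : ℝ} (hθ : 0 < θ) (hf3 : F3 f θ) {t : ℝ} (ht : 0 ≤ t) :
    0 ≤ Fint f t := by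
  rcases ht.eq_or_lt with rfl | ht
  · simp [Fint]
  · exact nonneg_of_mul_nonneg_right (hf3 t ht).1 hθ

lemma Fint_scaling {f : ℝ → ℝ} (hfc : Continuous f) {θ : ℝ} (hf3 : F3 f θ)
    {t r : ℝ} (ht : 1 ≤ t) (hr : 0 ≤ r) :
    t ^ (θ / 2) * Fint f r ≤ Fint f (t * r) := by
  rcases hr.eq_or_lt with rfl | hr
  · simp [Fint]
  have hder : ∀ x ∈ Set.Ioi (0 : ℝ), HasDerivAt (fun x => Fint f x * x ^ (-(θ / 2)))
      (f x * x ^ (-(θ / 2)) + Fint f x * (-(θ / 2) * x ^ (-(θ / 2) - 1))) x := by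
    intro x hx
    have h1 : HasDerivAt (Fint f) (f x) x := hfc.integral_hasStrictDerivAt 0 x |>.hasDerivAt
    exact h1.mul (Real.hasDerivAt_rpow_const (Or.inl (ne_of_gt hx)))
  have hmono : MonotoneOn (fun x => Fint f x * x ^ (-(θ / 2))) (Set.Ioi (0 : ℝ)) := by
    refine monotoneOn_of_deriv_nonneg (convex_Ioi 0)
      (fun x hx => (hder x hx).continuousAt.continuousWithinAt) ?_ ?_
    · rw [interior_Ioi]
      exact fun x hx => (hder x hx).differentiableAt.differentiableWithinAt
    · rw [interior_Ioi]
      intro x hx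
      have hx' : 0 < x := hx
      rw [(hder x hx).deriv]
      have e : x ^ (-(θ / 2)) = x ^ (-(θ / 2) - 1) * x := by
        rw [Real.rpow_sub_one hx'.ne']; field_simp
      rw [e]
      have h2 := (hf3 x hx').2
      have h3 : 0 ≤ x ^ (-(θ / 2) - 1) := by positivity
      have : f x * (x ^ (-(θ / 2) - 1) * x) + Fint f x * (-(θ / 2) * x ^ (-(θ / 2) - 1)) =
        x ^ (-(θ / 2) - 1) * ((2 * f x * x - θ * Fint f x) / 2) := by ring
      rw [this]
      exact mul_nonneg h3 (by linarith)
  have ht0 : 0 < t := by linarith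
  have h := hmono (Set.mem_Ioi.2 hr) (Set.mem_Ioi.2 (mul_pos ht0 hr))
    (le_mul_of_one_le_left hr.le ht)
  simp only at h
  rw [Real.mul_rpow ht0.le hr.le, ← mul_assoc] at h
  have h4 : 0 < r ^ (-(θ / 2)) := by positivity
  have h5 := le_of_mul_le_mul_right h h4
  rw [Real.rpow_neg ht0.le] at h5
  have h6 : 0 < t ^ (θ / 2) := by positivity
  calc _ ≤ t ^ (θ / 2) * (Fint f (t * r) * (t ^ (θ / 2))⁻¹) := by gcongr
    _ = _ := by field_simp

lemma summable_Fint {p : ℝ} (hp : 2 ≤ p) {f : ℝ → ℝ} (hf1 : F1 f p) {v : Z d → ℝ}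
    (hv0 : ∀ x, 0 ≤ v x) (hv : Summable fun x => v x ^ p) :
    Summable fun x => Fint f (v x) := by
  obtain ⟨δ, hδ, hf⟩ := hf1 1 one_pos
  refine Summable.of_norm_bounded_eventually hv ?_
  have hlim := hv.tendsto_cofinite_zero
  have hev := hlim.eventually_lt_const (Real.rpow_pos_of_pos hδ p)
  filter_upwards [hev] with x hx
  have hlt : v x < δ := (Real.rpow_lt_rpow_iff (hv0 x) hδ.le (by linarith)).1 hx
  have h1 : ‖∫ r in (0 : ℝ)..(v x), f r‖ ≤ v x ^ (p - 1) * |v x - 0| := by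
    refine intervalIntegral.norm_integral_le_of_norm_le_const fun r hr => ?_
    rw [Set.uIoc_of_le (hv0 x)] at hr
    have h2 := hf r hr.1 (hr.2.trans_lt hlt)
    rw [one_mul] at h2
    exact h2.trans (Real.rpow_le_rpow hr.1.le hr.2 (by linarith))
  refine h1.trans ?_
  rw [sub_zero, abs_of_nonneg (hv0 x)]
  rcases (hv0 x).eq_or_lt with h0 | h0
  · rw [← h0]; simp; positivity
  · rw [Real.rpow_sub_one h0.ne']
    apply le_of_eq; field_simp

lemma summable_u_rpow {p : ℝ} {W : Z d → Z d → ℝ} {h : Z d → ℝ} {h₀ : ℝ} (hh₀ : 0 < h₀)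
    (hh1 : ∀ x, h₀ ≤ h x) {u : Z d → ℝ} (hu0 : ∀ x, 0 ≤ u x) (humem : memH W h p u) :
    Summable fun x => u x ^ p := by
  refine Summable.of_nonneg_of_le (fun x => Real.rpow_nonneg (hu0 x) p) (fun x => ?_)
    (humem.2.mul_left h₀⁻¹)
  have h1 : 0 ≤ gradNorm W u x ^ p := Real.rpow_nonneg (Real.sqrt_nonneg _) p
  have h2 : 0 ≤ u x ^ p := Real.rpow_nonneg (hu0 x) p
  rw [abs_of_nonneg (hu0 x)]
  calc u x ^ p = h₀⁻¹ * (h₀ * u x ^ p) := by field_simp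
    _ ≤ _ := by
      gcongr
      have := mul_le_mul_of_nonneg_right (hh1 x) h2
      linarith

lemma summable_double {R : Z d → Z d → ℝ} (hR0 : ∀ x y, 0 ≤ R x y) {B : ℝ}
    (hRB : ∀ x y, R x y ≤ B) {a : Z d → ℝ} (ha0 : ∀ x, 0 ≤ a x) (ha : Summable a) :
    Summable fun q : Z d × Z d => R q.1 q.2 * a q.2 * a q.1 := by
  have h1 : Summable fun q : Z d × Z d => a q.1 * a q.2 := ha.mul_of_nonneg ha ha0 ha0
  refine Summable.of_nonneg_of_le
    (fun q => mul_nonneg (mul_nonneg (hR0 _ _) (ha0 _)) (ha0 _)) (fun q => ?_) (h1.mul_left B)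
  have h2 := mul_le_mul_of_nonneg_right (hRB q.1 q.2) (mul_nonneg (ha0 q.1) (ha0 q.2))
  linarith

lemma double_le {R : Z d → Z d → ℝ} (hR0 : ∀ x y, 0 ≤ R x y) {B : ℝ}
    (hRB : ∀ x y, R x y ≤ B) {a b : Z d → ℝ} (ha0 : ∀ x, 0 ≤ a x) (ha : Summable a)
    (hb0 : ∀ x, 0 ≤ b x) (hb : Summable b) {c : ℝ} (hc : 0 ≤ c) (hab : ∀ x, c * a x ≤ b x) :
    c * c * ∑' x, (∑' y, R x y * a y) * a x ≤ ∑' x, (∑' y, R x y * b y) * b x := by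
  have hs : ∀ {a : Z d → ℝ}, (∀ x, 0 ≤ a x) → Summable a → ∀ x,
      Summable fun y => R x y * a y := fun ha0 ha x =>
    Summable.of_nonneg_of_le (fun y => mul_nonneg (hR0 _ _) (ha0 _))
      (fun y => mul_le_mul_of_nonneg_right (hRB x y) (ha0 y)) (ha.mul_left B)
  have ho : ∀ {a : Z d → ℝ}, (∀ x, 0 ≤ a x) → Summable a →
      Summable fun x => (∑' y, R x y * a y) * a x := by
    intro a ha0 ha
    refine Summable.of_nonneg_of_le
      (fun x => mul_nonneg (tsum_nonneg fun y => mul_nonneg (hR0 _ _) (ha0 _)) (ha0 x))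
      (fun x => mul_le_mul_of_nonneg_right
        (Summable.tsum_le_tsum (fun y => mul_le_mul_of_nonneg_right (hRB x y) (ha0 y))
          (hs ha0 ha x) (ha.mul_left B)) (ha0 x)) (ha.mul_left _)
  rw [← tsum_mul_left]
  refine Summable.tsum_le_tsum (fun x => ?_) ((ho ha0 ha).mul_left _) (ho hb0 hb)
  have h1 : c * ∑' y, R x y * a y ≤ ∑' y, R x y * b y := by
    rw [← tsum_mul_left]
    refine Summable.tsum_le_tsum (fun y => ?_) ((hs ha0 ha x).mul_left _) (hs hb0 hb x)
    have := mul_le_mul_of_nonneg_left (hab y) (hR0 x y)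
    linarith
  calc c * c * ((∑' y, R x y * a y) * a x) = (c * ∑' y, R x y * a y) * (c * a x) := by ring
    _ ≤ _ := mul_le_mul h1 (hab x) (mul_nonneg hc (ha0 x))
      (tsum_nonneg fun y => mul_nonneg (hR0 _ _) (hb0 _))

theorem choquard_term_scaling_inequality
    {d : ℕ} (hd : 0 < d) {s p : ℝ} (hs : s ∈ Set.Ioo (0 : ℝ) 1) (hp : 2 ≤ p)
    {W : Z d → Z d → ℝ} (hW : KernelOK d s W)
    {α : ℝ} (hα : α ∈ Set.Ioo (0 : ℝ) (d : ℝ))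
    {h : Z d → ℝ} {h₀ : ℝ} (hh₀ : 0 < h₀) (hh1 : ∀ x, h₀ ≤ h x)
    {f : ℝ → ℝ} (hfc : Continuous f) (hfz : ∀ t ≤ (0 : ℝ), f t = 0)
    (hf1 : F1 f p)
    {C₀ τ : ℝ} (hC₀ : 0 < C₀) (hτ : ((d : ℝ) + α) * p / (2 * d) < τ)
    (hf2 : ∀ t > (0 : ℝ), f t ≤ C₀ * (1 + t ^ (τ - 1)))
    {θ : ℝ} (hθ : p < θ) (hf3 : F3 f θ)
    (u : Z d → ℝ) (hu0 : ∀ x, 0 ≤ u x) (hune : u ≠ 0) (humem : memH W h p u) :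
    ∀ t : ℝ, 1 ≤ t →
      (Summable fun q : Z d × Z d =>
        Riesz d α q.1 q.2 * Fint f (t * u q.2) * Fint f (t * u q.1)) ∧
      (Summable fun q : Z d × Z d =>
        Riesz d α q.1 q.2 * Fint f (u q.2) * Fint f (u q.1)) ∧
      t ^ θ * ∑' x : Z d, conv d α (fun y => Fint f (u y)) x * Fint f (u x) ≤
        ∑' x : Z d, conv d α (fun y => Fint f (t * u y)) x * Fint f (t * u x) := by
  intro t ht
  have ht0 : 0 < t := by linarith
  have hθ0 : 0 < θ := by linarith
  obtain ⟨B, hB⟩ := Riesz_bounded hd hα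
  have hR0 := Riesz_nonneg hd hα
  have hup := summable_u_rpow hh₀ hh1 hu0 humem
  have htu0 : ∀ x, 0 ≤ t * u x := fun x => mul_nonneg ht0.le (hu0 x)
  have htup : Summable fun x => (t * u x) ^ p := by
    refine (hup.mul_left (t ^ p)).congr fun x => ?_
    rw [Real.mul_rpow ht0.le (hu0 x)]
  have ha := summable_Fint hp hf1 hu0 hup
  have hb := summable_Fint hp hf1 htu0 htup
  have ha0 : ∀ x, 0 ≤ Fint f (u x) := fun x => Fint_nonneg hθ0 hf3 (hu0 x)
  have hb0 : ∀ x, 0 ≤ Fint f (t * u x) := fun x => Fint_nonneg hθ0 hf3 (htu0 x)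
  refine ⟨summable_double (R := Riesz d α) (a := fun x => Fint f (t * u x)) hR0 hB hb0 hb,
    summable_double (R := Riesz d α) (a := fun x => Fint f (u x)) hR0 hB ha0 ha, ?_⟩
  have hmain := double_le (R := Riesz d α) (a := fun x => Fint f (u x))
    (b := fun x => Fint f (t * u x)) hR0 hB ha0 ha hb0 hb (c := t ^ (θ / 2)) (by positivity)
    fun x => Fint_scaling hfc hf3 ht (hu0 x)
  rw [← Real.rpow_add ht0, add_halves] at hmain
  exact hmain

end DiscreteChoquard
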